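/- Global optimality: Suppose (ς̄,σ̄₁,σ̄₂) ∈ S⁺♯ is a critical point of P^d, i.e., the Fréchet derivative of (ς,σ₁,σ₂) ↦ P^d(ς,σ₁,σ₂) vanishes at (ς̄,σ̄₁,σ̄₂). Then (ς̄,σ̄₁,σ̄₂) is a global maximizer of P^d over S⁺♯; moreover, setting x̄ = G(ς̄,σ̄₁)⁻¹ c and v̄ᵢ = (fᵢ + σ̄₁ᵢ + σ̄₂ᵢ)/(2 σ̄₂ᵢ), the pair (x̄,v̄) belongs to X_v, is a global minimizer of P over X_v, and P(x̄,v̄) = P^d(ς̄,σ̄₁,σ̄₂). -/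

import Mathlib

open Matrix BigOperators

/-- `G(ς,σ₁) = A + ς B + 2 diag(σ₁)`. -/
noncomputable def Gm {n : ℕ} (A B : Matrix (Fin n) (Fin n) ℝ) (ς : ℝ) (σ₁ : Fin n → ℝ) :
    Matrix (Fin n) (Fin n) ℝ :=
  A + ς • B + (2 : ℝ) • Matrix.diagonal σ₁

/-- The primal objective `P(x,v)`. -/
noncomputable def Pobj {n : ℕ} (A B : Matrix (Fin n) (Fin n) ℝ) (α : ℝ) (c f : Fin n → ℝ)
    (x v : Fin n → ℝ) : ℝ :=
  (1/2) * (x ⬝ᵥ A.mulVec x) - c ⬝ᵥ x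
    + (1/2) * ((1/2) * (x ⬝ᵥ B.mulVec x) - α)^2 - f ⬝ᵥ v

/-- The primal feasible set `X_v`. -/
def Xv (n : ℕ) : Set ((Fin n → ℝ) × (Fin n → ℝ)) :=
  {p | ∀ i, (p.2 i = 0 ∨ p.2 i = 1) ∧ -p.2 i ≤ p.1 i ∧ p.1 i ≤ p.2 i}

/-- The canonical dual function `P^d(ς,σ₁,σ₂)`. -/
noncomputable def Pd {n : ℕ} (A B : Matrix (Fin n) (Fin n) ℝ) (α : ℝ) (c f : Fin n → ℝ)
    (p : ℝ × (Fin n → ℝ) × (Fin n → ℝ)) : ℝ :=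
  -(1/2) * (c ⬝ᵥ (Gm A B p.1 p.2.1)⁻¹.mulVec c)
    - (1/4) * ∑ i, (f i + p.2.1 i + p.2.2 i)^2 / p.2.2 i
    - (1/2) * p.1^2 - α * p.1

/-- The dual feasible set `S⁺♯`. -/
def Ssharp {n : ℕ} (A B : Matrix (Fin n) (Fin n) ℝ) (α : ℝ) :
    Set (ℝ × (Fin n → ℝ) × (Fin n → ℝ)) :=
  {p | -α ≤ p.1 ∧ (∀ i, 0 ≤ p.2.1 i) ∧ (∀ i, 0 < p.2.2 i) ∧ (Gm A B p.1 p.2.1).PosDef}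

section
attribute [local instance] Matrix.linftyOpNormedRing Matrix.linftyOpNormedAlgebra

lemma quad_inv_hasFDerivAt {n : ℕ} (M : Matrix (Fin n) (Fin n) ℝ) (hM : M.PosDef)
    (c : Fin n → ℝ) {E : Type*} [NormedAddCommGroup E] [NormedSpace ℝ E]
    (g : E → Matrix (Fin n) (Fin n) ℝ) (g' : E →L[ℝ] Matrix (Fin n) (Fin n) ℝ) (p : E)
    (hg : HasFDerivAt g g' p) (hp : g p = M) :
    ∃ φ : E →L[ℝ] ℝ, HasFDerivAt (fun q => c ⬝ᵥ (g q)⁻¹.mulVec c) φ p ∧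
      ∀ d, φ d = -(c ⬝ᵥ (M⁻¹ * g' d * M⁻¹).mulVec c) := by
  obtain ⟨u, hu⟩ := hM.isUnit
  let ℓ : Matrix (Fin n) (Fin n) ℝ →ₗ[ℝ] ℝ :=
    { toFun := fun N => c ⬝ᵥ N.mulVec c
      map_add' := by intro x y; simp [Matrix.add_mulVec]
      map_smul' := by intro r x; simp [Matrix.smul_mulVec] }
  have h1 := hasFDerivAt_ringInverse (𝕜 := ℝ) u
  rw [hu, ← hp] at h1
  have h2 := (LinearMap.toContinuousLinearMap ℓ).hasFDerivAt.comp p (h1.comp p hg)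
  refine ⟨_, h2.congr_of_eventuallyEq ?_, ?_⟩
  · refine Filter.Eventually.of_forall fun q => ?_
    simp [ℓ, Matrix.nonsing_inv_eq_ringInverse]
  · intro d
    have : (↑u⁻¹ : Matrix (Fin n) (Fin n) ℝ) = M⁻¹ := by
      rw [← hu, Matrix.coe_units_inv]
    change ℓ (-((↑u⁻¹ : Matrix (Fin n) (Fin n) ℝ) * g' d * (↑u⁻¹ : Matrix (Fin n) (Fin n) ℝ))) = _
    rw [this, map_neg]
    rfl

lemma quad_crit {n : ℕ} (A B : Matrix (Fin n) (Fin n) ℝ) (c : Fin n → ℝ)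
    (p : ℝ × (Fin n → ℝ) × (Fin n → ℝ)) (hM : (Gm A B p.1 p.2.1).PosDef) :
    ∃ φ : (ℝ × (Fin n → ℝ) × (Fin n → ℝ)) →L[ℝ] ℝ,
      HasFDerivAt (fun q : ℝ × (Fin n → ℝ) × (Fin n → ℝ) =>
        c ⬝ᵥ (Gm A B q.1 q.2.1)⁻¹.mulVec c) φ p ∧
      ∀ d, φ d = -(c ⬝ᵥ ((Gm A B p.1 p.2.1)⁻¹ * (d.1 • B + (2:ℝ) • Matrix.diagonal d.2.1)
        * (Gm A B p.1 p.2.1)⁻¹).mulVec c) := by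
  let L : (ℝ × (Fin n → ℝ) × (Fin n → ℝ)) →ₗ[ℝ] Matrix (Fin n) (Fin n) ℝ :=
    { toFun := fun d => d.1 • B + (2:ℝ) • Matrix.diagonal d.2.1
      map_add' := by
        intro x y
        simp only [Prod.fst_add, Prod.snd_add, ← Matrix.diagonal_add, add_smul, smul_add,
          Pi.add_def]
        abel
      map_smul' := by
        intro r x
        simp [Matrix.diagonal_smul, smul_smul, mul_comm] }
  have hg : HasFDerivAt (fun q : ℝ × (Fin n → ℝ) × (Fin n → ℝ) => Gm A B q.1 q.2.1)
      (LinearMap.toContinuousLinearMap L) p := by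
    have := (LinearMap.toContinuousLinearMap L).hasFDerivAt (x := p) |>.const_add A
    refine this.congr_of_eventuallyEq (Filter.Eventually.of_forall fun q => ?_)
    simp [L, Gm, add_assoc]
  obtain ⟨φ, h1, h2⟩ := quad_inv_hasFDerivAt _ hM c _ _ p hg rfl
  exact ⟨φ, h1, fun d => by rw [h2]; simp [L]⟩
end

lemma quot_deriv {n : ℕ} (f : Fin n → ℝ)
    (p : ℝ × (Fin n → ℝ) × (Fin n → ℝ)) (i : Fin n) (hp : 0 < p.2.2 i) :
    ∃ φ : (ℝ × (Fin n → ℝ) × (Fin n → ℝ)) →L[ℝ] ℝ,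
      HasFDerivAt (fun q : ℝ × (Fin n → ℝ) × (Fin n → ℝ) =>
        (f i + q.2.1 i + q.2.2 i)^2 / q.2.2 i) φ p ∧
      ∀ d, φ d = 2 * ((f i + p.2.1 i + p.2.2 i) / p.2.2 i) * (d.2.1 i + d.2.2 i)
        - ((f i + p.2.1 i + p.2.2 i) / p.2.2 i)^2 * d.2.2 i := by
  let a : (ℝ × (Fin n → ℝ) × (Fin n → ℝ)) →L[ℝ] ℝ :=
    (ContinuousLinearMap.proj i).comp ((ContinuousLinearMap.fst ℝ _ _).comp
      (ContinuousLinearMap.snd ℝ ℝ ((Fin n → ℝ) × (Fin n → ℝ))))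
  let b : (ℝ × (Fin n → ℝ) × (Fin n → ℝ)) →L[ℝ] ℝ :=
    (ContinuousLinearMap.proj i).comp ((ContinuousLinearMap.snd ℝ _ _).comp
      (ContinuousLinearMap.snd ℝ ℝ ((Fin n → ℝ) × (Fin n → ℝ))))
  have ha : HasFDerivAt (fun q : ℝ × (Fin n → ℝ) × (Fin n → ℝ) => q.2.1 i) a p := a.hasFDerivAt
  have hb : HasFDerivAt (fun q : ℝ × (Fin n → ℝ) × (Fin n → ℝ) => q.2.2 i) b p := b.hasFDerivAt
  have h := (((ha.const_add (f i)).add hb).pow 2).mul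
    ((hasDerivAt_inv hp.ne').comp_hasFDerivAt p hb)
  refine ⟨_, h.congr_of_eventuallyEq (Filter.Eventually.of_forall fun q => ?_), ?_⟩
  · simp [div_eq_mul_inv]
  · intro d
    have := hp.ne'
    simp [a, b]
    field_simp
    ring

lemma Pd_fderiv {n : ℕ} (A B : Matrix (Fin n) (Fin n) ℝ) (α : ℝ) (c f : Fin n → ℝ)
    (p : ℝ × (Fin n → ℝ) × (Fin n → ℝ)) (hM : (Gm A B p.1 p.2.1).PosDef)
    (hp : ∀ i, 0 < p.2.2 i) (d : ℝ × (Fin n → ℝ) × (Fin n → ℝ)) :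
    fderiv ℝ (Pd A B α c f) p d =
      (1/2) * (c ⬝ᵥ ((Gm A B p.1 p.2.1)⁻¹ * (d.1 • B + (2:ℝ) • Matrix.diagonal d.2.1)
        * (Gm A B p.1 p.2.1)⁻¹).mulVec c)
      - (1/4) * ∑ i, (2 * ((f i + p.2.1 i + p.2.2 i) / p.2.2 i) * (d.2.1 i + d.2.2 i)
        - ((f i + p.2.1 i + p.2.2 i) / p.2.2 i)^2 * d.2.2 i)
      - p.1 * d.1 - α * d.1 := by
  obtain ⟨φ, h1, h2⟩ := quad_crit A B c p hM
  choose ψ h3 h4 using fun i => quot_deriv f p i (hp i)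
  have hf : HasFDerivAt (fun q : ℝ × (Fin n → ℝ) × (Fin n → ℝ) => q.1)
    (ContinuousLinearMap.fst ℝ ℝ _) p := hasFDerivAt_fst
  have h := (((h1.const_mul (-(1/2) : ℝ)).sub
    ((HasFDerivAt.fun_sum (u := Finset.univ) fun i _ => h3 i).const_mul (1/4 : ℝ))).sub
    ((hf.pow 2).const_mul (1/2 : ℝ))).sub (hf.const_mul α)
  have h' : HasFDerivAt (Pd A B α c f) _ p :=
    h.congr_of_eventuallyEq (Filter.Eventually.of_forall fun q => by simp [Pd])
  rw [h'.fderiv]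
  simp only [ContinuousLinearMap.sub_apply, ContinuousLinearMap.smul_apply, smul_eq_mul,
    ContinuousLinearMap.sum_apply, h2, h4, ContinuousLinearMap.coe_fst']
  simp
  ring

/-- the total complementary function -/
noncomputable def Lag {n : ℕ} (A B : Matrix (Fin n) (Fin n) ℝ) (α : ℝ) (c f : Fin n → ℝ)
    (x v : Fin n → ℝ) (p : ℝ × (Fin n → ℝ) × (Fin n → ℝ)) : ℝ :=
  (1/2) * (x ⬝ᵥ (Gm A B p.1 p.2.1).mulVec x) - c ⬝ᵥ x
    + ∑ i, (p.2.2 i * (v i ^ 2 - v i) - (f i + p.2.1 i) * v i) - (1/2) * p.1^2 - α * p.1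

lemma quad_expand {n : ℕ} (A B : Matrix (Fin n) (Fin n) ℝ) (s : ℝ) (t x : Fin n → ℝ) :
    x ⬝ᵥ (Gm A B s t).mulVec x
      = x ⬝ᵥ A.mulVec x + s * (x ⬝ᵥ B.mulVec x) + 2 * ∑ i, t i * x i ^ 2 := by
  have : x ⬝ᵥ (Matrix.diagonal t).mulVec x = ∑ i, t i * x i ^ 2 := by
    simp only [dotProduct, Matrix.mulVec_diagonal]
    exact Finset.sum_congr rfl fun i _ => by ring
  simp only [Gm, Matrix.add_mulVec, Matrix.smul_mulVec, dotProduct_add, dotProduct_smul, this,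
    smul_eq_mul]

lemma Lag_sub {n : ℕ} (A B : Matrix (Fin n) (Fin n) ℝ) (α : ℝ) (c f : Fin n → ℝ)
    (x v : Fin n → ℝ) (p : ℝ × (Fin n → ℝ) × (Fin n → ℝ)) (hM : (Gm A B p.1 p.2.1).PosDef)
    (hp : ∀ i, 0 < p.2.2 i) :
    Lag A B α c f x v p - Pd A B α c f p =
      (1/2) * ((x - (Gm A B p.1 p.2.1)⁻¹.mulVec c) ⬝ᵥ
        (Gm A B p.1 p.2.1).mulVec (x - (Gm A B p.1 p.2.1)⁻¹.mulVec c)) +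
      ∑ i, p.2.2 i * (v i - (f i + p.2.1 i + p.2.2 i) / (2 * p.2.2 i))^2 := by
  unfold Lag Pd
  generalize hG : Gm A B p.1 p.2.1 = G at *
  have hc : G.mulVec (G⁻¹.mulVec c) = c := by
    rw [Matrix.mulVec_mulVec, Matrix.mul_nonsing_inv _ ((Matrix.isUnit_iff_isUnit_det _).1 hM.isUnit),
      Matrix.one_mulVec]
  have hsymm : (G⁻¹.mulVec c) ⬝ᵥ G.mulVec x = c ⬝ᵥ x := by
    have hT : Gᵀ = G := by simpa [Matrix.IsHermitian] using hM.isHermitian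
    rw [Matrix.dotProduct_mulVec, ← Matrix.mulVec_transpose, hT, hc]
  have hs : ∑ i, p.2.2 i * (v i - (f i + p.2.1 i + p.2.2 i) / (2 * p.2.2 i))^2 =
      ∑ i, (p.2.2 i * (v i ^ 2 - v i) - (f i + p.2.1 i) * v i) +
      (1/4) * ∑ i, (f i + p.2.1 i + p.2.2 i)^2 / p.2.2 i := by
    rw [Finset.mul_sum, ← Finset.sum_add_distrib]
    refine Finset.sum_congr rfl fun i _ => ?_
    have := (hp i).ne'
    field_simp
    ring
  rw [hs, Matrix.mulVec_sub, hc, sub_dotProduct, dotProduct_sub, dotProduct_sub, hsymm,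
    dotProduct_comm x c, dotProduct_comm (G⁻¹.mulVec c) c]
  ring

lemma Pd_le_Lag {n : ℕ} (A B : Matrix (Fin n) (Fin n) ℝ) (α : ℝ) (c f : Fin n → ℝ)
    (x v : Fin n → ℝ) (p : ℝ × (Fin n → ℝ) × (Fin n → ℝ)) (hM : (Gm A B p.1 p.2.1).PosDef)
    (hp : ∀ i, 0 < p.2.2 i) : Pd A B α c f p ≤ Lag A B α c f x v p := by
  have h := Lag_sub A B α c f x v p hM hp
  have h1 := hM.posSemidef.dotProduct_mulVec_nonneg (x - (Gm A B p.1 p.2.1)⁻¹.mulVec c)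
  have h2 : 0 ≤ ∑ i, p.2.2 i * (v i - (f i + p.2.1 i + p.2.2 i) / (2 * p.2.2 i))^2 :=
    Finset.sum_nonneg fun i _ => mul_nonneg (hp i).le (sq_nonneg _)
  simp only [star_trivial] at h1
  linarith

/-- difference between primal objective and Lagrangian -/
lemma Pobj_sub_Lag {n : ℕ} (A B : Matrix (Fin n) (Fin n) ℝ) (α : ℝ) (c f : Fin n → ℝ)
    (x v : Fin n → ℝ) (p : ℝ × (Fin n → ℝ) × (Fin n → ℝ)) :
    Pobj A B α c f x v - Lag A B α c f x v p =
      (1/2) * ((1/2) * (x ⬝ᵥ B.mulVec x) - α - p.1)^2 +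
      ∑ i, (p.2.1 i * (v i - x i ^ 2) - p.2.2 i * (v i ^ 2 - v i)) := by
  unfold Lag Pobj
  rw [quad_expand]
  have : ∑ i, (p.2.1 i * (v i - x i ^ 2) - p.2.2 i * (v i ^ 2 - v i)) =
      - ∑ i, (p.2.2 i * (v i ^ 2 - v i) - (f i + p.2.1 i) * v i) - f ⬝ᵥ v
      - ∑ i, p.2.1 i * x i ^ 2 := by
    simp only [dotProduct]
    rw [← Finset.sum_neg_distrib, ← Finset.sum_sub_distrib, ← Finset.sum_sub_distrib]
    exact Finset.sum_congr rfl fun i _ => by ring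
  rw [this]
  ring

theorem global_optimality {n : ℕ} (hn : 0 < n)
    (A B : Matrix (Fin n) (Fin n) ℝ) (hA : A.IsSymm) (hB : B.PosSemidef)
    (α : ℝ) (hα : 0 < α) (c f : Fin n → ℝ)
    (ςb : ℝ) (σ1b σ2b : Fin n → ℝ)
    (hmem : (ςb, σ1b, σ2b) ∈ Ssharp A B α)
    (hcrit : fderiv ℝ (Pd A B α c f) (ςb, σ1b, σ2b) = 0)
    (xb vb : Fin n → ℝ)
    (hx : xb = (Gm A B ςb σ1b)⁻¹.mulVec c)
    (hv : ∀ i, vb i = (f i + σ1b i + σ2b i) / (2 * σ2b i)) :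
    (∀ q ∈ Ssharp A B α, Pd A B α c f q ≤ Pd A B α c f (ςb, σ1b, σ2b)) ∧
    (xb, vb) ∈ Xv n ∧
    (∀ q ∈ Xv n, Pobj A B α c f xb vb ≤ Pobj A B α c f q.1 q.2) ∧
    Pobj A B α c f xb vb = Pd A B α c f (ςb, σ1b, σ2b) := by
  obtain ⟨-, h1, h2, hM⟩ := hmem
  simp only at h1 h2 hM
  have hquad : ∀ N : Matrix (Fin n) (Fin n) ℝ,
      c ⬝ᵥ ((Gm A B ςb σ1b)⁻¹ * N * (Gm A B ςb σ1b)⁻¹).mulVec c = xb ⬝ᵥ N.mulVec xb := by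
    intro N
    have hT : ((Gm A B ςb σ1b)⁻¹)ᵀ = (Gm A B ςb σ1b)⁻¹ := by
      simpa [Matrix.IsHermitian] using hM.inv.isHermitian
    rw [← Matrix.mulVec_mulVec, ← Matrix.mulVec_mulVec, ← hx, Matrix.dotProduct_mulVec,
      ← Matrix.mulVec_transpose, hT, ← hx]
  have hder := fun d => Pd_fderiv A B α c f (ςb, σ1b, σ2b) hM h2 d
  simp only [hcrit, hquad, ContinuousLinearMap.zero_apply] at hder
  have hvv : ∀ i, (f i + σ1b i + σ2b i) / σ2b i = 2 * vb i := by
    intro i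
    have := (h2 i).ne'
    rw [hv]; field_simp
  simp only [hvv] at hder
  have e1 : (1/2) * (xb ⬝ᵥ B.mulVec xb) - α = ςb := by
    have := hder (1, 0, 0)
    simp at this
    linarith
  have e2 : ∀ i, xb i ^ 2 = vb i := by
    intro i
    have := hder (0, Pi.single i 1, 0)
    simp [Matrix.smul_mulVec, Pi.single_apply, dotProduct, Matrix.mulVec_diagonal] at this
    linarith
  have e3 : ∀ i, vb i ^ 2 = vb i := by
    intro i
    have := hder (0, 0, Pi.single i 1)
    simp [Pi.single_apply] at this
    linarith
  have hLP : Pobj A B α c f xb vb = Lag A B α c f xb vb (ςb, σ1b, σ2b) := by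
    have := Pobj_sub_Lag A B α c f xb vb (ςb, σ1b, σ2b)
    simp only [e1, e2, e3] at this
    simp at this
    linarith
  have hLD : Lag A B α c f xb vb (ςb, σ1b, σ2b) = Pd A B α c f (ςb, σ1b, σ2b) := by
    have := Lag_sub A B α c f xb vb (ςb, σ1b, σ2b) hM h2
    simp only [← hx, ← hv] at this
    simp at this
    linarith
  refine ⟨?_, ?_, ?_, hLP.trans hLD⟩
  · rintro q ⟨-, -, q2, qM⟩
    have a1 := Pd_le_Lag A B α c f xb vb q qM q2
    have a2 := Pobj_sub_Lag A B α c f xb vb q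
    have a3 : ∑ i, (q.2.1 i * (vb i - xb i ^ 2) - q.2.2 i * (vb i ^ 2 - vb i)) = 0 :=
      Finset.sum_eq_zero fun i _ => by rw [e2, e3]; ring
    rw [a3] at a2
    have a4 := sq_nonneg ((1/2) * (xb ⬝ᵥ B.mulVec xb) - α - q.1)
    linarith
  · intro i
    have b2 := e2 i
    have b3 := e3 i
    have b4 : vb i = 0 ∨ vb i = 1 := by
      have : vb i * (vb i - 1) = 0 := by linarith
      rcases mul_eq_zero.1 this with h | h
      · exact Or.inl h
      · exact Or.inr (by linarith)
    refine ⟨b4, ?_⟩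
    have b5 : 0 ≤ vb i := by rcases b4 with h | h <;> simp [h]
    exact abs_le_of_sq_le_sq' (by simp only; linarith) b5
  · intro q hq
    have a1 := Pd_le_Lag A B α c f q.1 q.2 (ςb, σ1b, σ2b) hM h2
    have a2 := Pobj_sub_Lag A B α c f q.1 q.2 (ςb, σ1b, σ2b)
    have a3 : 0 ≤ ∑ i, (σ1b i * (q.2 i - q.1 i ^ 2) - σ2b i * (q.2 i ^ 2 - q.2 i)) := by
      refine Finset.sum_nonneg fun i _ => ?_
      obtain ⟨k1, k2, k3⟩ := hq i
      have k4 : q.2 i ^ 2 = q.2 i := by rcases k1 with h | h <;> simp [h]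
      have k5 : q.1 i ^ 2 ≤ q.2 i ^ 2 := sq_le_sq' k2 k3
      have k6 := mul_nonneg (h1 i) (show 0 ≤ q.2 i - q.1 i ^ 2 by linarith)
      rw [k4, sub_self, mul_zero, sub_zero]
      exact k6
    have a4 := sq_nonneg ((1/2) * (q.1 ⬝ᵥ B.mulVec q.1) - α - ςb)
    simp only at a2
    linarith
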